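/- (Zero-one law) Assume G is connected, E_neg is nonempty, the positive graph (V, E_pst) is connected, α ∈ (0,1), β > 0, and p_ij + p_ji > 0 for every {i,j} ∈ E. Define the events 𝒞 := {lim_{k→∞} W(k)W(k−1)⋯W(0) = U} (equivalently: for every initial x⁰ ∈ ℝⁿ, max_{i,j} |x_i(k) − x_j(k)| → 0) and 𝒟 := {limsup_{k→∞} ‖(I−U)W(k)W(k−1)⋯W(0)‖ = ∞} (equivalently: there exists a deterministic x⁰ ∈ ℝⁿ with limsup_{k→∞} max_{i,j} |x_i(k) − x_j(k)| = ∞). Then ℙ(𝒞) ∈ {0,1}, ℙ(𝒟) ∈ {0,1}, and ℙ(𝒞) + ℙ(𝒟) = 1. -/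

import Mathlib

open Matrix MeasureTheory Filter
open scoped ENNReal

noncomputable section

namespace SignedOpinion

/-- The vector `e i - e j` in `ℝⁿ`. -/
def esub {n : ℕ} (i j : Fin n) : Fin n → ℝ :=
  fun k => (if k = i then (1 : ℝ) else 0) - (if k = j then (1 : ℝ) else 0)

/-- The rank-one matrix `(e i - e j) (e i - e j)ᵀ`. -/
def dmatAux {n : ℕ} (i j : Fin n) : Matrix (Fin n) (Fin n) ℝ :=
  Matrix.vecMulVec (esub i j) (esub i j)

lemma dmatAux_symm {n : ℕ} (i j : Fin n) : dmatAux i j = dmatAux j i := by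
  ext a b
  simp only [dmatAux, esub, Matrix.vecMulVec_apply]
  ring

/-- `(e i - e j)(e i - e j)ᵀ` as a function of the unordered pair `{i, j}`. -/
def dmat {n : ℕ} : Sym2 (Fin n) → Matrix (Fin n) (Fin n) ℝ :=
  Sym2.lift ⟨dmatAux, dmatAux_symm⟩

/-- The averaging matrix `U = 𝟙𝟙ᵀ / n`. -/
def Umat (n : ℕ) : Matrix (Fin n) (Fin n) ℝ :=
  (n : ℝ)⁻¹ • Matrix.of (fun _ _ => (1 : ℝ))

/-- The positive update matrix `W⁺_{ij} = I - α (e i - e j)(e i - e j)ᵀ`. -/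
def Wpos {n : ℕ} (α : ℝ) (e : Sym2 (Fin n)) : Matrix (Fin n) (Fin n) ℝ :=
  1 - α • dmat e

/-- The negative update matrix `W⁻_{ij} = I + β (e i - e j)(e i - e j)ᵀ`. -/
def Wneg {n : ℕ} (β : ℝ) (e : Sym2 (Fin n)) : Matrix (Fin n) (Fin n) ℝ :=
  1 + β • dmat e

/-- The edge selection probability `μ({i,j}) = (p i j + p j i) / n`. -/
def edgeWeight {n : ℕ} (P : Matrix (Fin n) (Fin n) ℝ) : Sym2 (Fin n) → ℝ :=
  Sym2.lift ⟨fun i j => (P i j + P j i) / n, fun i j => by show (P i j + P j i) / n = (P j i + P i j) / n; rw [add_comm (P i j)]⟩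

/-- The weighted Laplacian of the graph on `Fin n` with edge set `Es`,
with weight `edgeWeight P e` on the edge `e`. -/
def lap {n : ℕ} (P : Matrix (Fin n) (Fin n) ℝ) (Es : Finset (Sym2 (Fin n))) :
    Matrix (Fin n) (Fin n) ℝ :=
  ∑ e ∈ Es, edgeWeight P e • dmat e

/-- The unit-weight (standard) Laplacian of the graph with edge set `Es`. -/
def lapStd {n : ℕ} (Es : Finset (Sym2 (Fin n))) : Matrix (Fin n) (Fin n) ℝ :=
  ∑ e ∈ Es, dmat e

/-- Largest (real) eigenvalue of a matrix. For a real symmetric matrix this is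
`λ_max`. -/
def lamMax {n : ℕ} (M : Matrix (Fin n) (Fin n) ℝ) : ℝ :=
  sSup {t : ℝ | ∃ v : Fin n → ℝ, v ≠ 0 ∧ M *ᵥ v = t • v}

/-- Smallest (real) eigenvalue of a matrix. -/
def lamMin {n : ℕ} (M : Matrix (Fin n) (Fin n) ℝ) : ℝ :=
  sInf {t : ℝ | ∃ v : Fin n → ℝ, v ≠ 0 ∧ M *ᵥ v = t • v}

/-- Second smallest eigenvalue of a (connected-graph) Laplacian: the smallest
eigenvalue attained by an eigenvector orthogonal to the all-ones vector. -/
def lam2 {n : ℕ} (M : Matrix (Fin n) (Fin n) ℝ) : ℝ :=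
  sInf {t : ℝ | ∃ v : Fin n → ℝ, v ≠ 0 ∧ (∑ i, v i = 0) ∧ M *ᵥ v = t • v}

/-- `P` is row-stochastic. -/
def RowStochastic {n : ℕ} (P : Matrix (Fin n) (Fin n) ℝ) : Prop :=
  (∀ i j, 0 ≤ P i j) ∧ ∀ i, ∑ j, P i j = 1

/-- `P` complies with the graph with edge set `E`. -/
def Complies {n : ℕ} (P : Matrix (Fin n) (Fin n) ℝ) (E : Finset (Sym2 (Fin n))) : Prop :=
  ∀ i j : Fin n, i ≠ j → 0 < P i j → s(i, j) ∈ E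

/-- The simple graph on `Fin n` with edge set `E`. -/
def graphOf {n : ℕ} (E : Finset (Sym2 (Fin n))) : SimpleGraph (Fin n) :=
  SimpleGraph.fromEdgeSet (↑E)

/-- `diam x = max_i x i - min_i x i`  (the quantity `𝔛` of the paper). -/
def diam {n : ℕ} (x : Fin n → ℝ) : ℝ := (⨆ i, x i) - ⨅ i, x i

/-- Selection alphabet `E ∪ {∗}` : an unordered node pair, or no selection. -/
abbrev Sel (n : ℕ) := Option (Sym2 (Fin n))

instance (n : ℕ) : MeasurableSpace (Sel n) := ⊤

/-- The update matrix triggered by a selection. -/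
def Wsel {n : ℕ} (α β : ℝ) (Epst Eneg : Finset (Sym2 (Fin n))) :
    Sel n → Matrix (Fin n) (Fin n) ℝ
  | none => 1
  | some e => if e ∈ Epst then Wpos α e else if e ∈ Eneg then Wneg β e else 1

/-- The belief process `x(k)` driven by the selection sequence `ω`. -/
def xproc {n : ℕ} (α β : ℝ) (Epst Eneg : Finset (Sym2 (Fin n))) (x0 : Fin n → ℝ)
    (ω : ℕ → Sel n) : ℕ → Fin n → ℝ
  | 0 => x0
  | k + 1 => Wsel α β Epst Eneg (ω k) *ᵥ xproc α β Epst Eneg x0 ω k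

/-- The matrix product `W(k) W(k-1) ⋯ W(0)`. -/
def Wprod {n : ℕ} (α β : ℝ) (Epst Eneg : Finset (Sym2 (Fin n))) (ω : ℕ → Sel n) :
    ℕ → Matrix (Fin n) (Fin n) ℝ
  | 0 => Wsel α β Epst Eneg (ω 0)
  | k + 1 => Wsel α β Epst Eneg (ω (k + 1)) * Wprod α β Epst Eneg ω k

/-- The one-step selection distribution `μ` on `E ∪ {∗}`. -/
def seldist {n : ℕ} (P : Matrix (Fin n) (Fin n) ℝ) (E : Finset (Sym2 (Fin n))) :
    Sel n → ℝ≥0∞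
  | none => ENNReal.ofReal (1 - ∑ e ∈ E, edgeWeight P e)
  | some e => if e ∈ E then ENNReal.ofReal (edgeWeight P e) else 0

/-- `ℙ` is the infinite product of `seldist P E`: the coordinates are i.i.d.
with per-coordinate distribution `seldist P E` (characterized on cylinders). -/
def IsIIDSel {n : ℕ} (ℙ : Measure (ℕ → Sel n)) (P : Matrix (Fin n) (Fin n) ℝ)
    (E : Finset (Sym2 (Fin n))) : Prop :=
  ∀ (K : Finset ℕ) (v : ℕ → Sel n),
    ℙ {ω | ∀ k ∈ K, ω k = v k} = ∏ k ∈ K, seldist P E (v k)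

/-- Selection alphabet for the asymmetric constrained model:
an ordered node pair (or `∗`), together with a tag in `{1,2,3}`. -/
abbrev Sel2 (n : ℕ) := Option (Fin n × Fin n) × Fin 3

instance (n : ℕ) : MeasurableSpace (Sel2 n) := ⊤

/-- weights `a, b, c` on the tags. -/
def wabc (a b c : ℝ) : Fin 3 → ℝ := ![a, b, c]

/-- Per-step distribution for the asymmetric constrained model: the pair
`({i,j}, t)` (represented by its ordered representative with `i < j`) has mass
`(wabc a b c t) · μ({i,j})`, and `(∗, t)` has mass `(wabc a b c t) · μ(∗)`. -/
def seldist2 {n : ℕ} (P : Matrix (Fin n) (Fin n) ℝ) (E : Finset (Sym2 (Fin n)))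
    (a b c : ℝ) : Sel2 n → ℝ≥0∞
  | (none, t) => ENNReal.ofReal (wabc a b c t) * ENNReal.ofReal (1 - ∑ e ∈ E, edgeWeight P e)
  | (some (i, j), t) =>
      if i < j ∧ s(i, j) ∈ E then
        ENNReal.ofReal (wabc a b c t) * ENNReal.ofReal (edgeWeight P s(i, j))
      else 0

/-- `ℙ` is the infinite product of `seldist2 P E a b c`. -/
def IsIIDSel2 {n : ℕ} (ℙ : Measure (ℕ → Sel2 n)) (P : Matrix (Fin n) (Fin n) ℝ)
    (E : Finset (Sym2 (Fin n))) (a b c : ℝ) : Prop :=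
  ∀ (K : Finset ℕ) (v : ℕ → Sel2 n),
    ℙ {ω | ∀ k ∈ K, ω k = v k} = ∏ k ∈ K, seldist2 P E a b c (v k)

/-- Projection onto `[-A, A]`. -/
def projA (A z : ℝ) : ℝ := max (-A) (min A z)

/-- `θ(e) = α` on positive edges, `-β` on negative edges. -/
def theta {n : ℕ} (α β : ℝ) (Epst Eneg : Finset (Sym2 (Fin n))) (e : Sym2 (Fin n)) : ℝ :=
  if e ∈ Epst then α else if e ∈ Eneg then -β else 0

/-- One step of the asymmetric constrained update. -/
def cstep {n : ℕ} (α β A : ℝ) (Epst Eneg : Finset (Sym2 (Fin n))) :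
    Sel2 n → (Fin n → ℝ) → (Fin n → ℝ)
  | (none, _), x => x
  | (some (i, j), t), x =>
      if t = 0 then
        Function.update x i
          (projA A ((1 - theta α β Epst Eneg s(i, j)) * x i + theta α β Epst Eneg s(i, j) * x j))
      else if t = 1 then
        Function.update x j
          (projA A ((1 - theta α β Epst Eneg s(i, j)) * x j + theta α β Epst Eneg s(i, j) * x i))
      else
        Function.update
          (Function.update x i
            (projA A ((1 - theta α β Epst Eneg s(i, j)) * x i + theta α β Epst Eneg s(i, j) * x j)))
          j
          (projA A ((1 - theta α β Epst Eneg s(i, j)) * x j + theta α β Epst Eneg s(i, j) * x i))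

/-- The constrained asymmetric belief process. -/
def cproc {n : ℕ} (α β A : ℝ) (Epst Eneg : Finset (Sym2 (Fin n))) (x0 : Fin n → ℝ)
    (ω : ℕ → Sel2 n) : ℕ → Fin n → ℝ
  | 0 => x0
  | k + 1 => cstep α β A Epst Eneg (ω k) (cproc α β A Epst Eneg x0 ω k)


lemma dmat_mulVec {n : ℕ} (i j : Fin n) (x : Fin n → ℝ) :
    dmat s(i, j) *ᵥ x = (x i - x j) • esub i j := by
  ext a
  change (Matrix.vecMulVec (esub i j) (esub i j) *ᵥ x) a = _
  rw [Matrix.vecMulVec_mulVec]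
  simp only [esub, dotProduct, sub_mul, Finset.sum_sub_distrib, ite_mul, one_mul, zero_mul,
    Finset.sum_ite_eq', Finset.mem_univ, if_true, Pi.smul_apply, op_smul_eq_smul,
    smul_eq_mul]

lemma Umat_mul_dmat {n : ℕ} (e : Sym2 (Fin n)) : Umat n * dmat e = 0 := by
  induction e using Sym2.ind with | _ i j =>
  ext a b
  simp [Umat, dmat, dmatAux, esub, Matrix.mul_apply, Matrix.vecMulVec_apply,
    ← Finset.sum_mul, ← Finset.mul_sum, Finset.sum_sub_distrib]

section Dynamics

variable {n : ℕ} {α β : ℝ} {Epst Eneg : Finset (Sym2 (Fin n))}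

lemma Umat_mul_Wsel (a : Sel n) : Umat n * Wsel α β Epst Eneg a = Umat n := by
  cases a with
  | none => simp [Wsel]
  | some e =>
    simp only [Wsel]
    split_ifs <;> simp [Wpos, Wneg, mul_sub, mul_add, Umat_mul_dmat]

lemma Umat_mul_Wprod (ω : ℕ → Sel n) (k : ℕ) :
    Umat n * Wprod α β Epst Eneg ω k = Umat n := by
  induction k with
  | zero => exact Umat_mul_Wsel _
  | succ k ih => rw [Wprod, ← Matrix.mul_assoc, Umat_mul_Wsel, ih]

lemma sum_Wprod_apply (hn : n ≠ 0) (ω : ℕ → Sel n) (k : ℕ) (b : Fin n) :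
    ∑ a, Wprod α β Epst Eneg ω k a b = 1 := by
  have hn' : (n : ℝ) ≠ 0 := by exact_mod_cast hn
  have h := congrFun (congrFun (Umat_mul_Wprod (α := α) (β := β) (Epst := Epst)
    (Eneg := Eneg) ω k) b) b
  simp only [Umat, Matrix.smul_apply, Matrix.mul_apply, Matrix.of_apply, smul_eq_mul, mul_one,
    ← Finset.mul_sum] at h
  exact mul_left_cancel₀ (inv_ne_zero hn') (h.trans (mul_one _).symm)

/-- The left shift on selection sequences, iterated `m` times. -/
def shift (m : ℕ) (ω : ℕ → Sel n) : ℕ → Sel n := fun k => ω (k + m)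

lemma Wprod_succ_eq_shift (ω : ℕ → Sel n) (k : ℕ) :
    Wprod α β Epst Eneg ω (k + 1) =
      Wprod α β Epst Eneg (shift 1 ω) k * Wsel α β Epst Eneg (ω 0) := by
  induction k with
  | zero => rfl
  | succ k ih => rw [Wprod, ih, ← Matrix.mul_assoc]; rfl

lemma xproc_succ_eq_Wprod (x : Fin n → ℝ) (ω : ℕ → Sel n) (k : ℕ) :
    xproc α β Epst Eneg x ω (k + 1) = Wprod α β Epst Eneg ω k *ᵥ x := by
  induction k with
  | zero => rfl
  | succ k ih => rw [xproc, ih, Matrix.mulVec_mulVec]; rfl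

lemma xproc_add (x : Fin n → ℝ) (ω : ℕ → Sel n) (k l : ℕ) :
    xproc α β Epst Eneg x ω (k + l) =
      xproc α β Epst Eneg (xproc α β Epst Eneg x ω k) (shift k ω) l := by
  induction l with
  | zero => rfl
  | succ l ih => rw [← add_assoc, xproc, ih, xproc, shift, add_comm l k]

lemma xproc_congr (x : Fin n → ℝ) {ω ω' : ℕ → Sel n} {k : ℕ} (h : ∀ i < k, ω i = ω' i) :
    xproc α β Epst Eneg x ω k = xproc α β Epst Eneg x ω' k := by
  induction k with
  | zero => rfl
  | succ k ih => rw [xproc, xproc, ih fun i hi => h i (by omega), h k (by omega)]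

lemma diam_le_two_mul_norm [NeZero n] (x : Fin n → ℝ) : diam x ≤ 2 * ‖x‖ := by
  have h1 : (⨆ i, x i) ≤ ‖x‖ := ciSup_le fun i => (le_abs_self _).trans (norm_le_pi_norm x i)
  have h2 : -‖x‖ ≤ ⨅ i, x i :=
    le_ciInf fun i => neg_le.1 ((neg_le_abs _).trans (norm_le_pi_norm x i))
  unfold diam
  linarith

lemma abs_sub_le_diam (x : Fin n → ℝ) (i j : Fin n) : |x i - x j| ≤ diam x := by
  have hu := fun i => le_ciSup (Set.finite_range x).bddAbove i
  have hl := fun i => ciInf_le (Set.finite_range x).bddBelow i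
  have := hu i; have := hu j; have := hl i; have := hl j
  unfold diam
  rw [abs_le]
  constructor <;> linarith

lemma Wsel_neg_mulVec (hdisj : Disjoint Epst Eneg) {i j : Fin n} (h : s(i, j) ∈ Eneg)
    (x : Fin n → ℝ) :
    Wsel α β Epst Eneg (some s(i, j)) *ᵥ x = x + (β * (x i - x j)) • esub i j := by
  have h' : s(i, j) ∉ Epst := fun h' => Finset.disjoint_left.1 hdisj h' h
  simp [Wsel, h, h', Wneg, Matrix.add_mulVec, Matrix.smul_mulVec, dmat_mulVec, smul_smul]

lemma Wsel_pos_mulVec {i j : Fin n} (h : s(i, j) ∈ Epst) (x : Fin n → ℝ) :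
    Wsel α β Epst Eneg (some s(i, j)) *ᵥ x = x + (-α * (x i - x j)) • esub i j := by
  simp [Wsel, h, Wpos, Matrix.sub_mulVec, Matrix.smul_mulVec, dmat_mulVec, smul_smul,
    sub_eq_add_neg (x : Fin n → ℝ)]

/-- Along a suitable selection of edges of bounded length, a difference between the beliefs of
`i` and `j` creates a proportional difference between those of `a` and `b`. -/
def Transfers (α β : ℝ) (Epst Eneg : Finset (Sym2 (Fin n))) (a b i j : Fin n) : Prop :=
  ∃ c > 0, ∃ L : ℕ, ∀ x : Fin n → ℝ, ∃ v : ℕ → Sel n, (∀ t, ∃ e ∈ Epst ∪ Eneg, v t = some e) ∧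
    ∃ l ≤ L, c * |x i - x j| ≤
      |xproc α β Epst Eneg x v l a - xproc α β Epst Eneg x v l b|

lemma Transfers.refl {a b : Fin n} (h : s(a, b) ∈ Eneg) : Transfers α β Epst Eneg a b a b :=
  ⟨1, one_pos, 0, fun x => ⟨fun _ => some s(a, b),
    fun _ => ⟨_, Finset.mem_union_right _ h, rfl⟩, 0, le_rfl, by simp [xproc]⟩⟩

lemma Transfers.symm {a b i j : Fin n} (h : Transfers α β Epst Eneg a b i j) :
    Transfers α β Epst Eneg a b j i := by
  simpa only [Transfers, abs_sub_comm] using h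

lemma Transfers.trans {a b i j k : Fin n} (h₁ : Transfers α β Epst Eneg a b i j)
    (h₂ : Transfers α β Epst Eneg a b j k) : Transfers α β Epst Eneg a b i k := by
  obtain ⟨c₁, hc₁, L₁, h₁⟩ := h₁
  obtain ⟨c₂, hc₂, L₂, h₂⟩ := h₂
  refine ⟨min c₁ c₂ / 2, by positivity, max L₁ L₂, fun x => ?_⟩
  have htri : |x i - x k| ≤ |x i - x j| + |x j - x k| := abs_sub_le _ _ _
  have hm : 0 < min c₁ c₂ := lt_min hc₁ hc₂
  rcases le_total |x i - x j| |x j - x k| with hle | hle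
  · obtain ⟨v, hv, l, hl, h⟩ := h₂ x
    refine ⟨v, hv, l, hl.trans (le_max_right _ _), le_trans ?_ h⟩
    calc min c₁ c₂ / 2 * |x i - x k| ≤ min c₁ c₂ / 2 * (2 * |x j - x k|) := by
          gcongr; linarith
      _ = min c₁ c₂ * |x j - x k| := by ring
      _ ≤ c₂ * |x j - x k| := by gcongr; exact min_le_right _ _
  · obtain ⟨v, hv, l, hl, h⟩ := h₁ x
    refine ⟨v, hv, l, hl.trans (le_max_left _ _), le_trans ?_ h⟩
    calc min c₁ c₂ / 2 * |x i - x k| ≤ min c₁ c₂ / 2 * (2 * |x i - x j|) := by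
          gcongr; linarith
      _ = min c₁ c₂ * |x i - x j| := by ring
      _ ≤ c₁ * |x i - x j| := by gcongr; exact min_le_left _ _

lemma Transfers.of_adj (hdisj : Disjoint Epst Eneg) (hα : 0 < α) (hβ : 0 < β)
    {a b i j k : Fin n} (h : Transfers α β Epst Eneg a b i j) (hjk : s(j, k) ∈ Epst ∪ Eneg)
    (hij : i ≠ j) (hik : i ≠ k) (hne : j ≠ k) : Transfers α β Epst Eneg a b j k := by
  obtain ⟨c, hc, L, h⟩ := h
  obtain ⟨γ, hγ, hW⟩ : ∃ γ : ℝ, γ ≠ 0 ∧ ∀ x : Fin n → ℝ,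
      Wsel α β Epst Eneg (some s(j, k)) *ᵥ x = x + (γ * (x j - x k)) • esub j k := by
    rcases Finset.mem_union.1 hjk with hp | hq
    · exact ⟨-α, by simpa using hα.ne', fun x => Wsel_pos_mulVec hp x⟩
    · exact ⟨β, hβ.ne', fun x => Wsel_neg_mulVec hdisj hq x⟩
  have hγ' : 0 < |γ| := abs_pos.2 hγ
  refine ⟨c * (|γ| / 2), by positivity, L + 1, fun x => ?_⟩
  set y := Wsel α β Epst Eneg (some s(j, k)) *ᵥ x with hy
  have hyi : y i = x i := by simp [hy, hW, esub, hij, hik]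
  have hyj : y j = x j + γ * (x j - x k) := by simp [hy, hW, esub, hne]
  have key : |γ| * |x j - x k| ≤ |x i - x j| + |y i - y j| := by
    rw [← abs_mul]
    have : γ * (x j - x k) = (x i - x j) - (y i - y j) := by rw [hyi, hyj]; ring
    rw [this]
    exact abs_sub _ _
  rcases le_total (|γ| / 2 * |x j - x k|) |x i - x j| with hle | hle
  · obtain ⟨v, hv, l, hl, h⟩ := h x
    refine ⟨v, hv, l, hl.trans (Nat.le_succ _), le_trans ?_ h⟩
    rw [mul_assoc]
    gcongr
  · obtain ⟨v, hv, l, hl, h⟩ := h y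
    refine ⟨fun t => Nat.casesOn t (some s(j, k)) v, ?_, l + 1, by omega, ?_⟩
    · rintro (_ | t)
      · exact ⟨_, hjk, rfl⟩
      · exact hv t
    · rw [add_comm l 1, xproc_add]
      refine le_trans ?_ h
      rw [mul_assoc]
      gcongr
      linarith

lemma transfers_of_connected (hdisj : Disjoint Epst Eneg) (hα : 0 < α) (hβ : 0 < β)
    (hconn : (graphOf (Epst ∪ Eneg)).Connected) {a b : Fin n} (hab : s(a, b) ∈ Eneg)
    (hne : a ≠ b) (i j : Fin n) : Transfers α β Epst Eneg a b i j := by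
  have hab' := Transfers.refl (α := α) (β := β) (Epst := Epst) hab
  have key : ∀ i, Transfers α β Epst Eneg a b a i := by
    intro i
    obtain ⟨p⟩ := hconn.preconnected i a
    induction p with
    | nil => exact hab'.trans hab'.symm
    | @cons u w z huw _ ih =>
      have ih := ih hab hne hab'
      have hmem : s(w, u) ∈ Epst ∪ Eneg := by
        have := huw.symm
        simp only [graphOf, SimpleGraph.fromEdgeSet_adj] at this
        exact_mod_cast this.1
      rcases eq_or_ne u z with rfl | hu
      · exact hab'.trans hab'.symm
      rcases eq_or_ne w z with rfl | hw
      · rcases eq_or_ne u b with rfl | hub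
        · exact hab'
        · exact hab'.symm.of_adj hdisj hα hβ hmem hne.symm hub.symm huw.ne.symm
      · exact ih.trans (ih.of_adj hdisj hα hβ hmem hw.symm hu.symm huw.ne.symm)
  exact (key i).symm.trans (key j)

lemma xproc_const_neg_sub (hdisj : Disjoint Epst Eneg) {a b : Fin n} (hab : s(a, b) ∈ Eneg)
    (hne : a ≠ b) (x : Fin n → ℝ) {v : ℕ → Sel n} (hv : ∀ t, v t = some s(a, b)) (k : ℕ) :
    xproc α β Epst Eneg x v k a - xproc α β Epst Eneg x v k b =
      (1 + 2 * β) ^ k * (x a - x b) := by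
  induction k with
  | zero => simp [xproc]
  | succ k ih =>
    rw [xproc, hv, Wsel_neg_mulVec hdisj hab, pow_succ', mul_assoc, ← ih]
    simp [esub, hne, hne.symm]
    ring

lemma exists_lt_diam (hdisj : Disjoint Epst Eneg) (hβ : 0 < β) {a b i j : Fin n}
    (hab : s(a, b) ∈ Eneg) (hne : a ≠ b) (h : Transfers α β Epst Eneg a b i j)
    {ε : ℝ} (hε : 0 < ε) (M : ℝ) :
    ∃ L : ℕ, ∀ x : Fin n → ℝ, ε ≤ |x i - x j| → ∃ v : ℕ → Sel n,
      (∀ t, ∃ e ∈ Epst ∪ Eneg, v t = some e) ∧ M < diam (xproc α β Epst Eneg x v L) := by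
  obtain ⟨c, hc, L, h⟩ := h
  obtain ⟨m, hm⟩ := pow_unbounded_of_one_lt (M / (c * ε)) (by linarith : 1 < 1 + 2 * β)
  rw [div_lt_iff₀ (by positivity)] at hm
  refine ⟨L + m, fun x hx => ?_⟩
  obtain ⟨v, hv, l, hl, hvl⟩ := h x
  refine ⟨fun t => if t < l then v t else some s(a, b), fun t => ?_, ?_⟩
  · dsimp only
    split_ifs
    · exact hv t
    · exact ⟨_, Finset.mem_union_right _ hab, rfl⟩
  · refine lt_of_lt_of_le ?_ (abs_sub_le_diam _ a b)
    rw [show L + m = l + (L - l + m) by omega, xproc_add,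
      xproc_const_neg_sub hdisj hab hne _ (fun t => by simp [shift]),
      xproc_congr (ω' := v) x (fun i hi => by simp [hi]), abs_mul, abs_of_pos (by positivity)]
    calc M < (1 + 2 * β) ^ m * (c * ε) := hm
      _ ≤ (1 + 2 * β) ^ (L - l + m) * (c * ε) := by gcongr <;> [linarith; omega]
      _ ≤ _ := by gcongr; exact (by gcongr : c * ε ≤ c * |x i - x j|).trans hvl

end Dynamics

section Probability

variable {n : ℕ}

instance (n : ℕ) : DiscreteMeasurableSpace (Sel n) := ⟨fun _ => trivial⟩

lemma measurable_of_forall_lt {X : Type*} [MeasurableSpace X] {f : (ℕ → Sel n) → X} (k : ℕ)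
    (hf : ∀ ω ω', (∀ i < k, ω i = ω' i) → f ω = f ω') : Measurable f := by
  let extend : (Fin k → Sel n) → (ℕ → Sel n) := fun u i => if h : i < k then u ⟨i, h⟩ else none
  have hfe : f = (f ∘ extend) ∘ fun ω (i : Fin k) => ω i := by
    ext ω
    exact hf _ _ fun i hi => by simp [extend, hi]
  rw [hfe]
  exact (measurable_of_countable _).comp (measurable_pi_lambda _ fun i => measurable_pi_apply _)

lemma measurableSet_of_forall_lt {S : Set (ℕ → Sel n)} (k : ℕ)
    (hS : ∀ ω ω', (∀ i < k, ω i = ω' i) → (ω ∈ S ↔ ω' ∈ S)) : MeasurableSet S :=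
  measurable_mem.1 (measurable_of_forall_lt k fun ω ω' h => propext (hS ω ω' h))

lemma measurable_shift (m : ℕ) : Measurable (shift (n := n) m) :=
  measurable_pi_lambda _ fun _ => measurable_pi_apply _

/-- The event that the selections at the times in `K` are those prescribed by `v`. -/
def cyl (K : Finset ℕ) (v : ℕ → Sel n) : Set (ℕ → Sel n) := {ω | ∀ k ∈ K, ω k = v k}

lemma measurableSet_cyl (K : Finset ℕ) (v : ℕ → Sel n) : MeasurableSet (cyl K v) := by
  have : cyl K v = ⋂ k ∈ K, (fun ω => ω k) ⁻¹' {v k} := by ext; simp [cyl]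
  rw [this]
  exact Finset.measurableSet_biInter _ fun k _ => measurable_pi_apply k (measurableSet_singleton _)

lemma measure_ext_of_cyl {μ ν : Measure (ℕ → Sel n)} [IsFiniteMeasure ν]
    (h : ∀ K v, μ (cyl K v) = ν (cyl K v)) : μ = ν := by
  refine IsProjectiveLimit.unique (P := fun I => ν.map I.restrict) (fun I => ?_) fun I => rfl
  refine Measure.ext_of_singleton fun u => ?_
  have hr : Measurable (I.restrict : (ℕ → Sel n) → _) := Finset.measurable_restrict I
  have hpre : (I.restrict : (ℕ → Sel n) → _) ⁻¹' {u} =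
      cyl I fun i => if hi : i ∈ I then u ⟨i, hi⟩ else none := by
    ext ω
    simp only [Set.mem_preimage, Set.mem_singleton_iff, cyl, Set.mem_ofPred_eq, funext_iff,
      Subtype.forall, Finset.restrict]
    refine forall₂_congr fun i hi => ?_
    simp [hi]
  rw [Measure.map_apply hr (measurableSet_singleton _),
    Measure.map_apply hr (measurableSet_singleton _), hpre, h]

variable {P : Matrix (Fin n) (Fin n) ℝ} {E : Finset (Sym2 (Fin n))} {ℙ : Measure (ℕ → Sel n)}
  [IsProbabilityMeasure ℙ]

lemma IsIIDSel.measure_cyl_inter_shift (hiid : IsIIDSel ℙ P E) {m : ℕ} {K : Finset ℕ}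
    (hK : ∀ k ∈ K, k < m) (v : ℕ → Sel n) {A : Set (ℕ → Sel n)} (hA : MeasurableSet A) :
    ℙ (cyl K v ∩ shift m ⁻¹' A) = ℙ (cyl K v) * ℙ A := by
  have key : (ℙ.restrict (cyl K v)).map (shift m) = ℙ (cyl K v) • ℙ := by
    have : IsFiniteMeasure (ℙ (cyl K v) • ℙ) := Measure.smul_finite _ (measure_ne_top _ _)
    refine measure_ext_of_cyl fun K' v' => ?_
    rw [Measure.map_apply (measurable_shift m) (measurableSet_cyl _ _),
      Measure.restrict_apply (measurable_shift m (measurableSet_cyl _ _)), Measure.smul_apply,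
      smul_eq_mul]
    have hd : Disjoint K (K'.map (addRightEmbedding m)) := by
      rw [Finset.disjoint_left]
      intro k hk hk'
      obtain ⟨t, -, rfl⟩ := Finset.mem_map.1 hk'
      have := hK _ hk
      simp at this
    have hset : shift m ⁻¹' cyl K' v' ∩ cyl K v =
        cyl (K.disjUnion _ hd) fun k => if k < m then v k else v' (k - m) := by
      ext ω
      simp only [cyl, Set.mem_inter_iff, Set.mem_preimage, Set.mem_ofPred_eq, Finset.mem_disjUnion,
        Finset.mem_map, addRightEmbedding_apply, shift]
      constructor
      · rintro ⟨h1, h2⟩ k (hk | ⟨t, ht, rfl⟩)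
        · simp [hK k hk, h2 k hk]
        · simpa using h1 t ht
      · intro h
        refine ⟨fun t ht => by simpa using h (t + m) (Or.inr ⟨t, ht, rfl⟩), fun k hk => ?_⟩
        simpa [hK k hk] using h k (Or.inl hk)
    rw [hset, cyl, hiid, cyl, hiid, cyl, hiid, Finset.prod_disjUnion, Finset.prod_map]
    congr 1
    · exact Finset.prod_congr rfl fun k hk => by simp [hK k hk]
    · exact Finset.prod_congr rfl fun k hk => by simp
  have := congrArg (· A) key
  rwa [Measure.map_apply (measurable_shift m) hA,
    Measure.restrict_apply (measurable_shift m hA), Set.inter_comm, Measure.smul_apply,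
    smul_eq_mul] at this

lemma IsIIDSel.measure_eq_zero_or_one (hiid : IsIIDSel ℙ P E) {A : Set (ℕ → Sel n)}
    (hA : MeasurableSet A) (hsub : ∀ m, shift m ⁻¹' A ⊆ A) : ℙ A = 0 ∨ ℙ A = 1 := by
  have hae : ∀ m, shift m ⁻¹' A =ᵐ[ℙ] A := fun m => by
    refine ae_eq_of_subset_of_measure_ge (hsub m) (le_of_eq ?_)
      (measurable_shift m hA).nullMeasurableSet (measure_ne_top _ _)
    simpa [cyl] using
      (hiid.measure_cyl_inter_shift (m := m) (K := ∅) (by simp) (fun _ => none) hA).symm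
  have key : ℙ.restrict A = ℙ A • ℙ := by
    have : IsFiniteMeasure (ℙ A • ℙ) := Measure.smul_finite _ (measure_ne_top _ _)
    refine measure_ext_of_cyl fun K v => ?_
    rw [Measure.restrict_apply (measurableSet_cyl _ _), Measure.smul_apply, smul_eq_mul, mul_comm,
      ← hiid.measure_cyl_inter_shift (m := K.sup id + 1)
        (fun k hk => Nat.lt_succ_of_le (Finset.le_sup (f := id) hk)) v hA]
    exact measure_congr ((ae_eq_refl _).inter (hae _).symm)
  have h := congrArg (· A) key
  simp only [Measure.restrict_apply_self, Measure.smul_apply, smul_eq_mul] at h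
  by_cases h0 : ℙ A = 0
  · exact Or.inl h0
  · right
    exact ((ENNReal.mul_right_inj h0 (measure_ne_top _ _)).1 (by rw [mul_one, ← h])).symm

variable {α β : ℝ} {Epst Eneg : Finset (Sym2 (Fin n))}

/-- The selection sequences along which `diam` stays at most `M` up to time `k`. -/
def boundedUpTo (α β : ℝ) (Epst Eneg : Finset (Sym2 (Fin n))) (x : Fin n → ℝ) (M : ℝ) (k : ℕ) :
    Set (ℕ → Sel n) :=
  {ω | ∀ t ≤ k, diam (xproc α β Epst Eneg x ω t) ≤ M}

lemma measurableSet_boundedUpTo (x : Fin n → ℝ) (M : ℝ) (k : ℕ) :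
    MeasurableSet (boundedUpTo α β Epst Eneg x M k) := by
  refine measurableSet_of_forall_lt k fun ω ω' h => forall₂_congr fun t ht => ?_
  rw [xproc_congr x fun i hi => h i (by omega)]

lemma boundedUpTo_subset (x : Fin n → ℝ) (M : ℝ) {k l : ℕ} (h : k ≤ l) :
    boundedUpTo α β Epst Eneg x M l ⊆ boundedUpTo α β Epst Eneg x M k :=
  fun _ hω t ht => hω t (ht.trans h)

lemma IsIIDSel.mul_measure_add_le (hiid : IsIIDSel ℙ P E) {c : ℝ≥0∞}
    (hc : ∀ e ∈ E, c ≤ seldist P E (some e)) {H : Set (Fin n → ℝ)} {M : ℝ} {L : ℕ}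
    (hH : ∀ x ∈ H, ∃ v : ℕ → Sel n, (∀ t, ∃ e ∈ E, v t = some e) ∧
      M < diam (xproc α β Epst Eneg x v L)) (x : Fin n → ℝ) (k : ℕ) :
    c ^ L * ℙ (boundedUpTo α β Epst Eneg x M k ∩ {ω | xproc α β Epst Eneg x ω k ∈ H}) +
      ℙ (boundedUpTo α β Epst Eneg x M (k + L)) ≤ ℙ (boundedUpTo α β Epst Eneg x M k) := by
  set B := boundedUpTo α β Epst Eneg x M
  set S := B k ∩ {ω | xproc α β Epst Eneg x ω k ∈ H}
  set T := B k \ B (k + L)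
  let extend : (Fin k → Sel n) → (ℕ → Sel n) := fun u i => if h : i < k then u ⟨i, h⟩ else none
  let f : (ℕ → Sel n) → (Fin k → Sel n) := fun ω i => ω i
  have hf : Measurable f := measurable_pi_lambda _ fun i => measurable_pi_apply _
  have hfib : ∀ u, f ⁻¹' {u} = cyl (Finset.range k) (extend u) := fun u => by
    ext ω
    simp only [Set.mem_preimage, Set.mem_singleton_iff, cyl, Set.mem_ofPred_eq, funext_iff,
      Finset.mem_range, Fin.forall_iff, f]
    exact forall₂_congr fun i hi => by simp [extend, hi]
  have hTm : MeasurableSet T :=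
    (measurableSet_boundedUpTo _ _ _).diff (measurableSet_boundedUpTo _ _ _)
  have hSm : MeasurableSet S := (measurableSet_boundedUpTo _ _ _).inter <|
    measurableSet_of_forall_lt k fun ω ω' h => by
      rw [Set.mem_ofPred_eq, Set.mem_ofPred_eq, xproc_congr x h]
  have htotal : ∀ {R : Set (ℕ → Sel n)}, MeasurableSet R → ℙ R = ∑ u, ℙ (f ⁻¹' {u} ∩ R) := by
    intro R hR
    have := sum_measure_preimage_singleton (μ := ℙ.restrict R) Finset.univ (f := f)
      fun y _ => hf (measurableSet_singleton y)
    simp only [Measure.restrict_apply (hf (measurableSet_singleton _)), Finset.coe_univ,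
      Set.preimage_univ, Measure.restrict_apply_univ] at this
    exact this.symm
  have hST : c ^ L * ℙ S ≤ ℙ T := by
    rw [htotal hSm, htotal hTm, Finset.mul_sum]
    refine Finset.sum_le_sum fun u _ => ?_
    rcases (f ⁻¹' {u} ∩ S).eq_empty_or_nonempty with he | ⟨ω₀, rfl, hω₀, hω₀H⟩
    · simp [he]
    obtain ⟨v, hv, hvM⟩ := hH _ hω₀H
    have hagree : ∀ ω ∈ f ⁻¹' {f ω₀}, ∀ i < k, ω i = ω₀ i := fun ω hω i hi =>
      congrFun (show f ω = f ω₀ from hω) ⟨i, hi⟩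
    have hsub : f ⁻¹' {f ω₀} ∩ shift k ⁻¹' cyl (Finset.range L) v ⊆ f ⁻¹' {f ω₀} ∩ T := by
      rintro ω ⟨hω, hωv⟩
      refine ⟨hω, fun t ht => ?_, fun hcon => ?_⟩
      · rw [xproc_congr x fun i hi => hagree ω hω i (by omega)]
        exact hω₀ t ht
      · refine (hcon (k + L) le_rfl).not_gt ?_
        rw [xproc_add, xproc_congr x (hagree ω hω),
          xproc_congr _ fun i hi => hωv i (Finset.mem_range.2 hi)]
        exact hvM
    calc c ^ L * ℙ (f ⁻¹' {f ω₀} ∩ S) ≤ ℙ (cyl (Finset.range L) v) * ℙ (f ⁻¹' {f ω₀}) := by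
          gcongr
          · rw [cyl, hiid]
            calc c ^ L = ∏ _t ∈ Finset.range L, c := by simp
              _ ≤ _ := Finset.prod_le_prod' fun t _ => by
                obtain ⟨e, he, hve⟩ := hv t
                rw [hve]
                exact hc e he
          · exact Set.inter_subset_left
      _ = ℙ (f ⁻¹' {f ω₀} ∩ shift k ⁻¹' cyl (Finset.range L) v) := by
          rw [hfib, hiid.measure_cyl_inter_shift (fun i hi => Finset.mem_range.1 hi) _
            (measurableSet_cyl _ _), mul_comm]
      _ ≤ _ := measure_mono hsub
  calc c ^ L * ℙ S + ℙ (B (k + L)) ≤ ℙ T + ℙ (B (k + L)) := by gcongr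
    _ = ℙ (B k) := by
      rw [← measure_union Set.disjoint_sdiff_left (measurableSet_boundedUpTo _ _ _),
        Set.sdiff_union_of_subset (boundedUpTo_subset x M (by omega))]

lemma IsIIDSel.ae_eventually_notMem (hiid : IsIIDSel ℙ P E) {c : ℝ≥0∞} (hc0 : c ≠ 0)
    (hc : ∀ e ∈ E, c ≤ seldist P E (some e)) {H : Set (Fin n → ℝ)} {M : ℝ} {L : ℕ}
    (hH : ∀ x ∈ H, ∃ v : ℕ → Sel n, (∀ t, ∃ e ∈ E, v t = some e) ∧
      M < diam (xproc α β Epst Eneg x v L)) (x : Fin n → ℝ) :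
    ∀ᵐ ω ∂ℙ, (∀ k, diam (xproc α β Epst Eneg x ω k) ≤ M) →
      ∀ᶠ k in atTop, xproc α β Epst Eneg x ω k ∉ H := by
  set B := boundedUpTo α β Epst Eneg x M
  have hsum : ∑' k, ℙ (B k ∩ {ω | xproc α β Epst Eneg x ω k ∈ H}) ≠ ∞ := by
    have hbound : c ^ L * ∑' k, ℙ (B k ∩ {ω | xproc α β Epst Eneg x ω k ∈ H}) ≤ L := by
      rw [← ENNReal.tsum_mul_left, ENNReal.tsum_eq_iSup_nat]
      refine iSup_le fun N => ?_
      have hfin : ∑ k ∈ Finset.range N, ℙ (B (L + k)) ≠ ∞ :=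
        ENNReal.sum_ne_top.2 fun _ _ => measure_ne_top _ _
      refine (ENNReal.add_le_add_iff_right hfin).1 ?_
      calc _ ≤ ∑ k ∈ Finset.range N, ℙ (B k) := by
            rw [← Finset.sum_add_distrib]
            refine Finset.sum_le_sum fun k _ => ?_
            rw [add_comm L k]
            exact hiid.mul_measure_add_le hc hH x k
        _ ≤ ∑ k ∈ Finset.range (L + N), ℙ (B k) :=
            Finset.sum_le_sum_of_subset (Finset.range_mono (by omega))
        _ = ∑ k ∈ Finset.range L, ℙ (B k) + ∑ k ∈ Finset.range N, ℙ (B (L + k)) :=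
            Finset.sum_range_add _ _ _
        _ ≤ _ := by
            gcongr
            calc _ ≤ ∑ _k ∈ Finset.range L, (1 : ℝ≥0∞) :=
                  Finset.sum_le_sum fun _ _ => prob_le_one
              _ = L := by simp
    intro htop
    rw [htop, ENNReal.mul_top (pow_ne_zero _ hc0)] at hbound
    exact absurd hbound (by simp)
  have hnull := measure_setOfPred_frequently_eq_zero hsum
  rw [← compl_mem_ae_iff] at hnull
  filter_upwards [hnull] with ω hω hM
  refine (not_frequently.1 hω).mono fun k hk hkH => hk ⟨fun t _ => hM t, hkH⟩

end Probability

section Dichotomy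

variable {n : ℕ} {α β : ℝ} {Epst Eneg : Finset (Sym2 (Fin n))}

lemma edgeWeight_pos (hn : 0 < n) {P : Matrix (Fin n) (Fin n) ℝ} {E : Finset (Sym2 (Fin n))}
    (hpw : ∀ i j : Fin n, s(i, j) ∈ E → 0 < P i j + P j i) {e : Sym2 (Fin n)} (he : e ∈ E) :
    0 < edgeWeight P e := by
  induction e using Sym2.ind with | _ i j =>
  exact div_pos (hpw i j he) (by exact_mod_cast hn)

lemma exists_le_seldist (hn : 0 < n) {P : Matrix (Fin n) (Fin n) ℝ} {E : Finset (Sym2 (Fin n))}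
    (hpw : ∀ i j : Fin n, s(i, j) ∈ E → 0 < P i j + P j i) :
    ∃ c : ℝ≥0∞, c ≠ 0 ∧ ∀ e ∈ E, c ≤ seldist P E (some e) := by
  refine ⟨E.inf fun e => seldist P E (some e), ?_, fun e he => Finset.inf_le he⟩
  refine (((Finset.lt_inf_iff ENNReal.zero_lt_top).2 fun e he => ?_).ne')
  simpa [seldist, he] using edgeWeight_pos hn hpw he

lemma tendsto_Umat_of_shift {ω : ℕ → Sel n} (m : ℕ)
    (h : Tendsto (fun k => Wprod α β Epst Eneg (shift m ω) k) atTop (nhds (Umat n))) :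
    Tendsto (fun k => Wprod α β Epst Eneg ω k) atTop (nhds (Umat n)) := by
  induction m generalizing ω with
  | zero => exact h
  | succ m ih =>
    have h1 : Tendsto (fun k => Wprod α β Epst Eneg (shift 1 ω) k) atTop (nhds (Umat n)) :=
      ih h
    rw [← tendsto_add_atTop_iff_nat 1]
    simp only [Wprod_succ_eq_shift]
    have h2 := h1.mul_const (Wsel α β Epst Eneg (ω 0))
    rwa [Umat_mul_Wsel] at h2

lemma measurableSet_tendsto_Umat :
    MeasurableSet {ω : ℕ → Sel n |
      Tendsto (fun k => Wprod α β Epst Eneg ω k) atTop (nhds (Umat n))} := by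
  have hset : {ω : ℕ → Sel n |
      Tendsto (fun k => Wprod α β Epst Eneg ω k) atTop (nhds (Umat n))} =
      ⋂ a, ⋂ b, {ω | Tendsto (fun k => Wprod α β Epst Eneg ω k a b) atTop
        (nhds (Umat n a b))} := by
    ext ω
    simp only [Set.mem_iInter, Set.mem_ofPred_eq]
    exact tendsto_pi_nhds.trans (forall_congr' fun _ => tendsto_pi_nhds)
  rw [hset]
  refine MeasurableSet.iInter fun a => MeasurableSet.iInter fun b => ?_
  refine measurableSet_tendsto _ fun k => measurable_of_forall_lt (k + 1) fun ω ω' h => ?_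
  have hW : Wprod α β Epst Eneg ω k = Wprod α β Epst Eneg ω' k := by
    ext i j
    have hx := xproc_congr (α := α) (β := β) (Epst := Epst) (Eneg := Eneg) (Pi.single j 1) h
    simpa [xproc_succ_eq_Wprod] using congrFun hx i
  rw [hW]

lemma exists_diam_le_of_tendsto [NeZero n] {ω : ℕ → Sel n}
    (h : Tendsto (fun k => Wprod α β Epst Eneg ω k) atTop (nhds (Umat n))) (x : Fin n → ℝ) :
    ∃ C, ∀ k, diam (xproc α β Epst Eneg x ω k) ≤ C := by
  have hx : Tendsto (xproc α β Epst Eneg x ω) atTop (nhds (Umat n *ᵥ x)) := by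
    rw [← tendsto_add_atTop_iff_nat 1]
    simp only [xproc_succ_eq_Wprod]
    exact ((continuous_id.matrix_mulVec continuous_const).tendsto _).comp h
  obtain ⟨C, hC⟩ := hx.norm.bddAbove_range
  exact ⟨2 * C, fun k => (diam_le_two_mul_norm _).trans
    (by gcongr; exact hC (Set.mem_range_self k))⟩

lemma tendsto_Umat_of_tendsto_sub (hn : n ≠ 0) {ω : ℕ → Sel n}
    (h : ∀ a a' b, Tendsto (fun k => xproc α β Epst Eneg (Pi.single b 1) ω k a -
      xproc α β Epst Eneg (Pi.single b 1) ω k a') atTop (nhds 0)) :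
    Tendsto (fun k => Wprod α β Epst Eneg ω k) atTop (nhds (Umat n)) := by
  refine tendsto_pi_nhds.2 fun a => tendsto_pi_nhds.2 fun b => ?_
  have hn' : (n : ℝ) ≠ 0 := by exact_mod_cast hn
  have hsub : ∀ a', Tendsto (fun k => Wprod α β Epst Eneg ω k a b -
      Wprod α β Epst Eneg ω k a' b) atTop (nhds 0) := fun a' => by
    have := (tendsto_add_atTop_iff_nat 1).2 (h a a' b)
    simpa [xproc_succ_eq_Wprod] using this
  have hsum := ((tendsto_finsetSum Finset.univ fun a' _ => hsub a').const_mul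
    (n : ℝ)⁻¹).const_add (n : ℝ)⁻¹
  simp only [Finset.sum_sub_distrib, sum_Wprod_apply hn, Finset.sum_const, Finset.card_univ,
    Fintype.card_fin, nsmul_eq_mul, mul_zero, smul_zero, add_zero] at hsum
  have hU : Umat n a b = (n : ℝ)⁻¹ := by simp [Umat]
  rw [hU]
  refine hsum.congr fun k => ?_
  field_simp
  ring

lemma IsIIDSel.ae_tendsto_or_unbounded (hn : 0 < n) (hdisj : Disjoint Epst Eneg)
    (hloop : ∀ e ∈ Epst ∪ Eneg, ¬ e.IsDiag) {P : Matrix (Fin n) (Fin n) ℝ}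
    (hconn : (graphOf (Epst ∪ Eneg)).Connected) (hneg : Eneg.Nonempty)
    (hpw : ∀ i j : Fin n, s(i, j) ∈ Epst ∪ Eneg → 0 < P i j + P j i)
    (hα : 0 < α) (hβ : 0 < β) {ℙ : Measure (ℕ → Sel n)} [IsProbabilityMeasure ℙ]
    (hiid : IsIIDSel ℙ P (Epst ∪ Eneg)) :
    ∀ᵐ ω ∂ℙ, Tendsto (fun k => Wprod α β Epst Eneg ω k) atTop (nhds (Umat n)) ∨
      ∃ x, ∀ C : ℝ, ∃ k, C < diam (xproc α β Epst Eneg x ω k) := by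
  obtain ⟨c, hc0, hc⟩ := exists_le_seldist hn hpw
  obtain ⟨e, he⟩ := hneg
  induction e using Sym2.ind with | _ a b =>
  have hab : a ≠ b := by simpa using hloop _ (Finset.mem_union_right _ he)
  have key : ∀ᵐ ω ∂ℙ, ∀ (i j d : Fin n) (M m : ℕ),
      (∀ k, diam (xproc α β Epst Eneg (Pi.single d 1) ω k) ≤ M) →
        ∀ᶠ k in atTop, |xproc α β Epst Eneg (Pi.single d 1) ω k i -
          xproc α β Epst Eneg (Pi.single d 1) ω k j| < 1 / ((m : ℝ) + 1) := by
    simp only [ae_all_iff]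
    intro i j d M m
    obtain ⟨L, hL⟩ := exists_lt_diam hdisj hβ he hab
      (transfers_of_connected hdisj hα hβ hconn he hab i j) (Nat.one_div_pos_of_nat (n := m)) M
    have := hiid.ae_eventually_notMem hc0 hc
      (H := {x | 1 / ((m : ℝ) + 1) ≤ |x i - x j|}) hL (Pi.single d 1)
    simpa only [Set.mem_ofPred_eq, not_le] using this
  filter_upwards [key] with ω hω
  refine or_iff_not_imp_right.2 fun hbdd => ?_
  push Not at hbdd
  refine tendsto_Umat_of_tendsto_sub hn.ne' fun i j d => ?_
  obtain ⟨C, hC⟩ := hbdd (Pi.single d 1)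
  obtain ⟨M, hM⟩ := exists_nat_ge C
  rw [Metric.tendsto_nhds]
  intro ε hε
  obtain ⟨m, hm⟩ := exists_nat_one_div_lt hε
  filter_upwards [hω i j d M m fun k => (hC k).trans hM] with k hk
  simpa [Real.dist_eq] using hk.trans hm

end Dichotomy

theorem zero_one_law
    (n : ℕ) (hn : 3 ≤ n)
    (Epst Eneg : Finset (Sym2 (Fin n)))
    (hdisj : Disjoint Epst Eneg)
    (hloop : ∀ e ∈ Epst ∪ Eneg, ¬ e.IsDiag)
    (P : Matrix (Fin n) (Fin n) ℝ)
    (hP : RowStochastic P)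
    (hPc : Complies P (Epst ∪ Eneg))
    (hconn : (graphOf (Epst ∪ Eneg)).Connected)
    (hneg : Eneg.Nonempty)
    (hpconn : (graphOf Epst).Connected)
    (hpw : ∀ i j : Fin n, s(i, j) ∈ Epst ∪ Eneg → 0 < P i j + P j i)
    (α β : ℝ) (hα0 : 0 < α) (hα1 : α < 1) (hβ : 0 < β)
    (ℙ : Measure (ℕ → Sel n)) [IsProbabilityMeasure ℙ]
    (hiid : IsIIDSel ℙ P (Epst ∪ Eneg)) :
    (ℙ {ω | Tendsto (fun k : ℕ => Wprod α β Epst Eneg ω k) atTop (nhds (Umat n))} = 0 ∨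
     ℙ {ω | Tendsto (fun k : ℕ => Wprod α β Epst Eneg ω k) atTop (nhds (Umat n))} = 1) ∧
    (ℙ {ω | ∃ x0 : Fin n → ℝ, ∀ C : ℝ, ∃ k : ℕ, C < diam (xproc α β Epst Eneg x0 ω k)} = 0 ∨
     ℙ {ω | ∃ x0 : Fin n → ℝ, ∀ C : ℝ, ∃ k : ℕ, C < diam (xproc α β Epst Eneg x0 ω k)} = 1) ∧
    ℙ {ω | Tendsto (fun k : ℕ => Wprod α β Epst Eneg ω k) atTop (nhds (Umat n))} +
      ℙ {ω | ∃ x0 : Fin n → ℝ, ∀ C : ℝ, ∃ k : ℕ, C < diam (xproc α β Epst Eneg x0 ω k)} = 1 := by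
  have : NeZero n := ⟨by omega⟩
  set 𝒞 := {ω | Tendsto (fun k : ℕ => Wprod α β Epst Eneg ω k) atTop (nhds (Umat n))}
  set 𝒟 := {ω | ∃ x0 : Fin n → ℝ, ∀ C : ℝ, ∃ k : ℕ, C < diam (xproc α β Epst Eneg x0 ω k)}
  have hmeas : MeasurableSet 𝒞 := measurableSet_tendsto_Umat
  have hC : ℙ 𝒞 = 0 ∨ ℙ 𝒞 = 1 :=
    hiid.measure_eq_zero_or_one hmeas fun m _ hω => tendsto_Umat_of_shift m hω
  have hD : ℙ 𝒟 = ℙ 𝒞ᶜ := by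
    refine measure_congr (eventuallyEq_set.2 ?_)
    filter_upwards [hiid.ae_tendsto_or_unbounded (by omega) hdisj hloop hconn hneg hpw hα0 hβ]
      with ω hω
    refine ⟨fun ⟨x, hx⟩ hωC => ?_, fun h => hω.resolve_left h⟩
    obtain ⟨C, hC⟩ := exists_diam_le_of_tendsto hωC x
    obtain ⟨k, hk⟩ := hx C
    exact (hC k).not_gt hk
  have hadd : ℙ 𝒞 + ℙ 𝒟 = 1 := by rw [hD, prob_add_prob_compl hmeas]
  refine ⟨hC, ?_, hadd⟩
  rcases hC with h | h
  · right
    simpa [h] using hadd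
  · left
    rw [hD, prob_compl_eq_zero_iff hmeas, h]

end SignedOpinion
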